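/- If G ≠ K₂ is a ℤ/3-flow-critical graph of maximum degree three, then G = K₄. -/

import Mathlib

open Finset

/-- A multigraph with a fixed orientation of its edges: each edge has a
tail and a head. -/
structure MultiGraph where
  V : Type
  E : Type
  [fV : Fintype V]
  [fE : Fintype E]
  [dV : DecidableEq V]
  [dE : DecidableEq E]
  tail : E → V
  head : E → V

namespace MultiGraph

attribute [instance] fV fE dV dE

variable (G : MultiGraph)

/-- The incidence sign `[v,e]`: `1` if `e` is oriented towards `v`, `-1` if
oriented away from `v`, `0` otherwise (so `0` on loops). -/
def sign (v : G.V) (e : G.E) : ℤ :=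
  (if G.head e = v then 1 else 0) - (if G.tail e = v then 1 else 0)

/-- A flow with values in an abelian group: conservation at every vertex. -/
def IsFlow {A : Type*} [AddCommGroup A] (φ : G.E → A) : Prop :=
  ∀ v : G.V, ∑ e : G.E, G.sign v e • φ e = 0

/-- A nowhere-zero flow. -/
def IsNZFlow {A : Type*} [AddCommGroup A] (φ : G.E → A) : Prop :=
  G.IsFlow φ ∧ ∀ e : G.E, φ e ≠ 0

/-- `G` admits a nowhere-zero `A`-flow. -/
def HasNZFlow (A : Type*) [AddCommGroup A] : Prop :=
  ∃ φ : G.E → A, G.IsNZFlow φ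

/-- Two vertices are joined by an edge (in either direction). -/
def Adj (a b : G.V) : Prop :=
  ∃ e : G.E, (G.tail e = a ∧ G.head e = b) ∨ (G.tail e = b ∧ G.head e = a)

/-- `G` is connected. -/
def Connected : Prop :=
  Nonempty G.V ∧ ∀ a b : G.V, Relation.ReflTransGen G.Adj a b

/-- Contraction of a set of edges: the contracted edges are removed and
their endpoints identified. -/
noncomputable def contract (S : Set G.E) : MultiGraph := by
  classical
  exact
  { V := Quot (fun a b : G.V => ∃ e ∈ S, G.tail e = a ∧ G.head e = b)
    E := {e : G.E // e ∉ S}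
    fV := Fintype.ofSurjective (Quot.mk _) (Quot.mk_surjective)
    tail := fun e => Quot.mk _ (G.tail e.1)
    head := fun e => Quot.mk _ (G.head e.1) }

/-- `G` is `A`-flow-critical: `G` is connected, has no nowhere-zero `A`-flow,
but every single-edge contraction does. -/
noncomputable def FlowCritical (A : Type*) [AddCommGroup A] : Prop :=
  G.Connected ∧ ¬ G.HasNZFlow A ∧ ∀ e : G.E, (G.contract {e}).HasNZFlow A

/-- The degree of a vertex (loops counted twice). -/
def degree (v : G.V) : ℕ :=
  (univ.filter fun e : G.E => G.tail e = v).card +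
    (univ.filter fun e : G.E => G.head e = v).card

/-- Incidence of a vertex and an edge. -/
def Incident (v : G.V) (e : G.E) : Prop := G.tail e = v ∨ G.head e = v

/-- The vector `δ_v ∈ (ℤ/3)^{E(G)}`, `δ_v(e) = [v,e]`. -/
def deltaV (v : G.V) : G.E → ZMod 3 := fun e => (G.sign v e : ZMod 3)

/-- The vector `δ_{v,e₁,e₂}`: `[v,e₁]` on `e₁`, `-[v,e₂]` on `e₂`, `0` elsewhere. -/
def deltaPair (v : G.V) (e₁ e₂ : G.E) : G.E → ZMod 3 := fun e =>
  if e = e₁ then (G.sign v e₁ : ZMod 3)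
  else if e = e₂ then -(G.sign v e₂ : ZMod 3) else 0

/-- The dot product on `(ℤ/3)^{E(G)}`. -/
def dot (c φ : G.E → ZMod 3) : ZMod 3 := ∑ e : G.E, c e * φ e

/-- The subspace `Δ_v`: the span of `δ_v` if `deg v ≠ 3`, and the span of `δ_v`
together with the vectors `δ_{v,e₁,e₂}` for incident edges if `deg v = 3`. -/
def DeltaSub (v : G.V) : Submodule (ZMod 3) (G.E → ZMod 3) :=
  if G.degree v = 3 then
    Submodule.span (ZMod 3) ({G.deltaV v} ∪
      {x | ∃ e₁ e₂ : G.E, e₁ ≠ e₂ ∧ G.Incident v e₁ ∧ G.Incident v e₂ ∧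
        x = G.deltaPair v e₁ e₂})
  else Submodule.span (ZMod 3) {G.deltaV v}

/-- Isomorphism of multigraphs (edges may be reversed, since the orientation
is an arbitrary fixed choice). -/
def Iso (G H : MultiGraph) : Prop :=
  ∃ (f : G.V ≃ H.V) (g : G.E ≃ H.E), ∀ e : G.E,
    (H.tail (g e) = f (G.tail e) ∧ H.head (g e) = f (G.head e)) ∨
    (H.tail (g e) = f (G.head e) ∧ H.head (g e) = f (G.tail e))

/-- The graph with two vertices joined by `m` parallel edges. -/
def banana (m : ℕ) : MultiGraph where
  V := Bool
  E := Fin m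
  tail := fun _ => false
  head := fun _ => true

/-- The wheel `W_k`: a cycle on `k` vertices plus a hub (`none`) adjacent to all
of them.  `Sum.inl` are the cycle edges, `Sum.inr` the spokes. -/
def wheel (k : ℕ) : MultiGraph where
  V := Option (Fin k)
  E := Fin k ⊕ Fin k
  tail := fun e => Sum.elim (fun i => some i) (fun i => some i) e
  head := fun e => Sum.elim (fun i => some (finRotate k i)) (fun _ => none) e

/-- `K₂`. -/
def K2 : MultiGraph := banana 1

/-- `K₄` (the wheel on `3 + 1` vertices). -/
def K4 : MultiGraph := wheel 3

/-- `G` is a wheel. -/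
def IsWheel : Prop := ∃ k : ℕ, 3 ≤ k ∧ Iso G (wheel k)

end MultiGraph

namespace MultiGraph

variable {G : MultiGraph}

/-- The projection of the vertices of `G` onto those of `G / e`. -/
def contractProj (G : MultiGraph) (e : G.E) : G.V → (G.contract {e}).V := Quot.mk _

theorem contractProj_eq_iff (e : G.E) (a b : G.V) :
    G.contractProj e a = G.contractProj e b ↔
      (if a = G.head e then G.tail e else a) = (if b = G.head e then G.tail e else b) := by
  have key : ∀ a : G.V, G.contractProj e (if a = G.head e then G.tail e else a) =
      G.contractProj e a := by
    intro a
    split_ifs with h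
    · subst h
      exact Quot.sound ⟨e, rfl, rfl, rfl⟩
    · rfl
  constructor
  · intro h
    refine congrArg (Quot.lift (fun a : G.V => if a = G.head e then G.tail e else a) ?_) h
    rintro a b ⟨f, hf, rfl, rfl⟩
    obtain rfl : f = e := hf
    simp
  · intro h
    rw [← key a, ← key b, h]

theorem sum_contract_eq_zero {e : G.E} {φ : (G.contract {e}).E → ZMod 3}
    (hφ : (G.contract {e}).IsFlow φ) (q : (G.contract {e}).V) :
    ∑ f : G.E, ((if G.contractProj e (G.head f) = q then 1 else 0) -
      (if G.contractProj e (G.tail f) = q then 1 else 0) : ℤ) •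
        (if h : f = e then 0 else φ ⟨f, h⟩) = 0 := by
  rw [← Finset.add_sum_erase univ _ (mem_univ e), dif_pos rfl, smul_zero, zero_add,
    Finset.sum_subtype (p := fun f => f ∉ ({e} : Set G.E)) (univ.erase e) (by simp)]
  refine .trans ?_ (hφ q)
  refine Finset.sum_congr
    (by ext x; exact iff_of_true (mem_univ _) (mem_univ (α := (G.contract {e}).E) x)) ?_
  rintro ⟨f, hf⟩ -
  exact congrArg (_ • ·) (dif_neg hf)

/-- In a graph which is critical for `ℤ/3`-flows, every edge is the zero set of a flow. -/
theorem FlowCritical.exists_flow (hG : G.FlowCritical (ZMod 3)) (e : G.E) :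
    ∃ φ : G.E → ZMod 3, G.IsFlow φ ∧ ∀ f, φ f = 0 ↔ f = e := by
  obtain ⟨-, hno, hcon⟩ := hG
  obtain ⟨φ', hφ', hnz⟩ := hcon e
  have hsum := sum_contract_eq_zero hφ'
  set ψ : G.E → ZMod 3 := fun f => if h : f = e then 0 else φ' ⟨f, h⟩ with hψ
  have hψ0 : ∀ f, ψ f = 0 ↔ f = e := by
    intro f
    by_cases h : f = e
    · simp [hψ, h]
    · simp only [hψ, dif_neg h, h, iff_false]
      exact hnz _
  have hother : ∀ v, v ≠ G.tail e → v ≠ G.head e → ∑ f, G.sign v f • ψ f = 0 := by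
    intro v ht hh
    rw [← hsum (G.contractProj e v)]
    refine Finset.sum_congr rfl fun f _ => ?_
    congr 1
    simp only [sign, contractProj_eq_iff]
    grind
  by_cases hloop : G.tail e = G.head e
  · refine ⟨ψ, fun v => ?_, hψ0⟩
    rw [← hsum (G.contractProj e v)]
    refine Finset.sum_congr rfl fun f _ => ?_
    congr 1
    simp only [sign, contractProj_eq_iff]
    grind
  have hboth : ∑ f, G.sign (G.tail e) f • ψ f + ∑ f, G.sign (G.head e) f • ψ f = 0 := by
    rw [← hsum (G.contractProj e (G.tail e)), ← Finset.sum_add_distrib]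
    refine Finset.sum_congr rfl fun f _ => ?_
    rw [← add_smul]
    congr 1
    simp only [sign, contractProj_eq_iff]
    grind
  have hadd : ∀ x v, ∑ f, G.sign v f • (ψ f + if f = e then x else 0) =
      ∑ f, G.sign v f • ψ f + G.sign v e • x := by
    intro x v
    simp [smul_add, Finset.sum_add_distrib]
  set x := ∑ f, G.sign (G.tail e) f • ψ f with hx
  have hflow : G.IsFlow fun f => ψ f + if f = e then x else 0 := by
    intro v
    rw [hadd]
    by_cases ht : v = G.tail e
    · subst ht
      rw [← hx]
      simp [sign, Ne.symm hloop]
    by_cases hh : v = G.head e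
    · subst hh
      simpa [sign, hloop, add_comm] using hboth
    · rw [hother v ht hh]
      simp [sign, Ne.symm ht, Ne.symm hh]
  refine ⟨_, hflow, fun f => ?_⟩
  by_cases hx0 : x = 0
  · simp [hx0, hψ0]
  · refine absurd ⟨_, hflow, fun f => ?_⟩ hno
    by_cases hf : f = e
    · simp [hf, hx0, (hψ0 e).2]
    · simp [hf, hψ0]

/-- `G.Joins e a b` means that `a` and `b` are the ends of `e`. -/
def Joins (G : MultiGraph) (e : G.E) (a b : G.V) : Prop :=
  (G.tail e = a ∧ G.head e = b) ∨ (G.tail e = b ∧ G.head e = a)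

theorem Joins.symm {e : G.E} {a b : G.V} (h : G.Joins e a b) : G.Joins e b a := Or.symm h

theorem iso_of_bijective {H : MultiGraph} {F : H.V → G.V} {g : H.E → G.E}
    (hF : Function.Bijective F) (hg : Function.Bijective g)
    (h : ∀ k, G.Joins (g k) (F (H.tail k)) (F (H.head k))) : Iso G H := by
  refine ⟨(Equiv.ofBijective F hF).symm, (Equiv.ofBijective g hg).symm, fun e => ?_⟩
  obtain ⟨k, rfl⟩ := hg.2 e
  rw [Equiv.ofBijective_symm_apply_apply]
  rcases h k with ⟨h₁, h₂⟩ | ⟨h₁, h₂⟩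
  · left
    simp [h₁, h₂]
  · right
    simp [h₁, h₂]

/-- The edges incident with a vertex. -/
def edgesAt (G : MultiGraph) (v : G.V) : Finset G.E :=
  univ.filter fun e => G.tail e = v ∨ G.head e = v

theorem mem_edgesAt {v : G.V} {e : G.E} : e ∈ G.edgesAt v ↔ G.tail e = v ∨ G.head e = v := by
  simp [edgesAt]

theorem sign_eq_zero_of_notMem {v : G.V} {e : G.E} (h : e ∉ G.edgesAt v) : G.sign v e = 0 := by
  rw [mem_edgesAt, not_or] at h
  simp [sign, h.1, h.2]

theorem isFlow_iff_sum_edgesAt {φ : G.E → ZMod 3} :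
    G.IsFlow φ ↔ ∀ v, ∑ e ∈ G.edgesAt v, (G.sign v e : ZMod 3) * φ e = 0 := by
  refine forall_congr' fun v => ?_
  rw [Finset.sum_subset (subset_univ (G.edgesAt v))
    fun e _ he => by simp [sign_eq_zero_of_notMem he]]
  simp only [zsmul_eq_mul]

theorem FlowCritical.tail_ne_head (hG : G.FlowCritical (ZMod 3)) (e : G.E) :
    G.tail e ≠ G.head e := by
  intro h
  obtain ⟨φ, hφ, h0⟩ := hG.exists_flow e
  refine hG.2.1 ⟨fun f => if f = e then 1 else φ f, fun v => ?_, fun f => ?_⟩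
  · rw [← hφ v]
    refine Finset.sum_congr rfl fun f _ => ?_
    by_cases hf : f = e
    · simp [hf, sign, h]
    · simp [hf]
  · by_cases hf : f = e
    · simp [hf]
    · simp [hf, h0]

theorem FlowCritical.cast_sign_ne_zero (hG : G.FlowCritical (ZMod 3)) {v : G.V} {e : G.E}
    (he : e ∈ G.edgesAt v) : (G.sign v e : ZMod 3) ≠ 0 := by
  have := hG.tail_ne_head e
  rcases mem_edgesAt.1 he with rfl | rfl <;> simp [sign, this, this.symm]

theorem FlowCritical.card_edgesAt (hG : G.FlowCritical (ZMod 3)) (v : G.V) :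
    (G.edgesAt v).card = G.degree v := by
  rw [edgesAt, degree, Finset.filter_or, Finset.card_union_of_disjoint]
  rw [Finset.disjoint_filter]
  rintro e - rfl h
  exact hG.tail_ne_head e h.symm

theorem Connected.forall_of_adj (hG : G.Connected) {P : G.V → Prop} {v : G.V} (hv : P v)
    (h : ∀ a b, G.Adj a b → P a → P b) (w : G.V) : P w := by
  induction hG.2 v w with
  | refl => exact hv
  | tail _ hab ih => exact h _ _ hab ih

theorem FlowCritical.edgesAt_nonempty (hG : G.FlowCritical (ZMod 3)) (v : G.V) :
    (G.edgesAt v).Nonempty := by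
  by_contra h
  rw [Finset.not_nonempty_iff_eq_empty] at h
  have hv : ∀ w, w = v := hG.1.forall_of_adj rfl <| by
    rintro a b ⟨e, he⟩ rfl
    have : e ∈ G.edgesAt a := mem_edgesAt.2 (he.imp And.left And.right)
    simp [h] at this
  have hE : IsEmpty G.E := ⟨fun e => by
    have : e ∈ G.edgesAt v := mem_edgesAt.2 (.inl (hv _))
    simp [h] at this⟩
  exact hG.2.1 ⟨0, fun w => by simp, isEmptyElim⟩

theorem FlowCritical.iso_K2 (hG : G.FlowCritical (ZMod 3)) {v : G.V}
    (hv : (G.edgesAt v).card = 1) : Iso G K2 := by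
  obtain ⟨e, he⟩ := Finset.card_eq_one.1 hv
  have hE : ∀ f, f = e := by
    intro f
    by_contra hf
    obtain ⟨φ, hφ, h0⟩ := hG.exists_flow f
    have h := isFlow_iff_sum_edgesAt.1 hφ v
    rw [he, Finset.sum_singleton, mul_eq_zero, h0] at h
    exact h.elim (hG.cast_sign_ne_zero (by simp [he])) fun h => hf h.symm
  have hV : ∀ w, w = G.tail e ∨ w = G.head e := by
    refine hG.1.forall_of_adj (.inl rfl) ?_
    rintro a b ⟨f, hf⟩ -
    obtain rfl := hE f
    rcases hf with ⟨-, rfl⟩ | ⟨rfl, -⟩ <;> simp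
  have hne := hG.tail_ne_head e
  let F : Bool → G.V := fun b => if b then G.head e else G.tail e
  have hF : Function.Bijective F := by
    refine ⟨?_, fun w => ?_⟩
    · rintro (_ | _) (_ | _) h <;> simp_all [F]
    · rcases hV w with rfl | rfl
      · exact ⟨false, rfl⟩
      · exact ⟨true, rfl⟩
  have hg : Function.Bijective fun _ : Fin 1 => e :=
    ⟨fun _ _ _ => Subsingleton.elim _ _, fun f => ⟨0, (hE f).symm⟩⟩
  exact iso_of_bijective (H := K2) hF hg fun _ => .inl ⟨rfl, rfl⟩

theorem FlowCritical.card_edgesAt_ne_two (hG : G.FlowCritical (ZMod 3)) (v : G.V) :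
    (G.edgesAt v).card ≠ 2 := by
  intro h
  obtain ⟨e, f, hef, he⟩ := Finset.card_eq_two.1 h
  obtain ⟨φ, hφ, h0⟩ := hG.exists_flow e
  have h := isFlow_iff_sum_edgesAt.1 hφ v
  rw [he, Finset.sum_pair hef, (h0 e).2 rfl, mul_zero, zero_add, mul_eq_zero, h0] at h
  exact h.elim (hG.cast_sign_ne_zero (by simp [he])) hef.symm

theorem FlowCritical.card_edgesAt_eq_three (hG : G.FlowCritical (ZMod 3)) (hK2 : ¬ Iso G K2)
    (hdeg : ∀ v : G.V, G.degree v ≤ 3) (v : G.V) : (G.edgesAt v).card = 3 := by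
  have h0 := (hG.edgesAt_nonempty v).card_pos
  have h1 := mt (hG.iso_K2 (v := v)) hK2
  have h2 := hG.card_edgesAt_ne_two v
  have h3 := (hG.card_edgesAt v).trans_le (hdeg v)
  omega

theorem Joins.mem_edgesAt_iff {e : G.E} {a b v : G.V} (h : G.Joins e a b) :
    e ∈ G.edgesAt v ↔ v = a ∨ v = b := by
  rw [mem_edgesAt]
  rcases h with ⟨rfl, rfl⟩ | ⟨rfl, rfl⟩ <;> grind

theorem Joins.sign_eq_neg {e : G.E} {a b : G.V} (h : G.Joins e a b) :
    G.sign b e = -G.sign a e := by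
  rcases h with ⟨rfl, rfl⟩ | ⟨rfl, rfl⟩ <;> simp [sign] <;> grind

theorem exists_joins_of_mem {e : G.E} {v : G.V} (h : e ∈ G.edgesAt v) : ∃ w, G.Joins e v w := by
  rcases mem_edgesAt.1 h with h | h
  · exact ⟨_, .inl ⟨h, rfl⟩⟩
  · exact ⟨_, .inr ⟨rfl, h⟩⟩

theorem FlowCritical.joins_ne (hG : G.FlowCritical (ZMod 3)) {e : G.E} {a b : G.V}
    (h : G.Joins e a b) : a ≠ b := by
  have := hG.tail_ne_head e
  rcases h with ⟨rfl, rfl⟩ | ⟨rfl, rfl⟩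
  exacts [this, this.symm]

/-- At a vertex of degree three, a flow which does not vanish there consists of ingoing edges only
or of outgoing edges only. -/
theorem FlowCritical.sign_mul_eq (hG : G.FlowCritical (ZMod 3)) {φ : G.E → ZMod 3}
    (hφ : G.IsFlow φ) {v : G.V} (hv : (G.edgesAt v).card = 3) (h0 : ∀ e ∈ G.edgesAt v, φ e ≠ 0)
    {e f : G.E} (he : e ∈ G.edgesAt v) (hf : f ∈ G.edgesAt v) :
    (G.sign v e : ZMod 3) * φ e = G.sign v f * φ f := by
  have hne : ∀ e ∈ G.edgesAt v, (G.sign v e : ZMod 3) * φ e ≠ 0 := fun e he =>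
    mul_ne_zero (hG.cast_sign_ne_zero he) (h0 e he)
  obtain ⟨a, b, c, hab, hac, hbc, h⟩ := Finset.card_eq_three.1 hv
  have hsum := isFlow_iff_sum_edgesAt.1 hφ v
  rw [h, Finset.sum_insert (by simp [hab, hac]), Finset.sum_pair hbc] at hsum
  have ha := hne a (by simp [h])
  have hb := hne b (by simp [h])
  have hc := hne c (by simp [h])
  have key : ∀ x y z : ZMod 3, x ≠ 0 → y ≠ 0 → z ≠ 0 → x + (y + z) = 0 → x = z ∧ y = z := by
    decide
  obtain ⟨h₁, h₂⟩ := key _ _ _ ha hb hc hsum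
  have hall : ∀ e ∈ G.edgesAt v, (G.sign v e : ZMod 3) * φ e = G.sign v c * φ c := by
    intro e he
    rw [h] at he
    simp only [mem_insert, mem_singleton] at he
    rcases he with rfl | rfl | rfl
    exacts [h₁, h₂, rfl]
  rw [hall e he, hall f hf]

theorem FlowCritical.eq_of_joins (hG : G.FlowCritical (ZMod 3))
    (h3 : ∀ v, (G.edgesAt v).card = 3) {e f : G.E} {u w : G.V} (he : G.Joins e u w)
    (hf : G.Joins f u w) : e = f := by
  by_contra hef
  have heu : e ∈ G.edgesAt u := he.mem_edgesAt_iff.2 (.inl rfl)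
  have hfu : f ∈ G.edgesAt u := hf.mem_edgesAt_iff.2 (.inl rfl)
  have hew : e ∈ G.edgesAt w := he.mem_edgesAt_iff.2 (.inr rfl)
  have hfw : f ∈ G.edgesAt w := hf.mem_edgesAt_iff.2 (.inr rfl)
  obtain ⟨g, hg⟩ : ∃ g, ((G.edgesAt u).erase e).erase f = {g} := by
    rw [← Finset.card_eq_one, Finset.card_erase_of_mem (by simp [hfu, Ne.symm hef]),
      Finset.card_erase_of_mem heu, h3]
  have hgu : g ∈ ((G.edgesAt u).erase e).erase f := by simp [hg]
  simp only [mem_erase] at hgu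
  obtain ⟨hgf, hge, hgu⟩ := hgu
  have hu : G.edgesAt u = {e, f, g} := by
    rw [← hg, Finset.insert_erase (by simp [hfu, Ne.symm hef]), Finset.insert_erase heu]
  by_cases hgw : g ∈ G.edgesAt w
  · have huw := hG.joins_ne he
    have hgj : G.Joins g u w := by
      obtain ⟨x, hx⟩ := exists_joins_of_mem hgu
      rcases hx.mem_edgesAt_iff.1 hgw with rfl | rfl
      · exact absurd rfl huw
      · exact hx
    have hjoin : ∀ h ∈ G.edgesAt u, G.Joins h u w := by
      intro h hh
      rw [hu] at hh
      simp only [mem_insert, mem_singleton] at hh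
      rcases hh with rfl | rfl | rfl <;> assumption
    have hw : G.edgesAt u = G.edgesAt w :=
      Finset.eq_of_subset_of_card_le (fun h hh => (hjoin h hh).mem_edgesAt_iff.2 (.inr rfl))
        (by rw [h3, h3])
    obtain ⟨φ, hφ, h0⟩ := hG.exists_flow e
    rw [isFlow_iff_sum_edgesAt] at hφ
    have hsq : ∑ h ∈ G.edgesAt u, (G.sign u h : ZMod 3) * G.sign u h = 0 := by
      rw [Finset.sum_congr rfl (g := fun _ => (1 : ZMod 3)), Finset.sum_const, h3]
      · decide
      · intro h hh
        have := hG.cast_sign_ne_zero hh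
        generalize (G.sign u h : ZMod 3) = x at *
        revert x
        decide
    refine hG.2.1 ⟨fun h => if h ∈ G.edgesAt u then G.sign u h else φ h,
      isFlow_iff_sum_edgesAt.2 fun v => ?_, fun h => ?_⟩
    · by_cases hvu : v = u
      · subst hvu
        rw [← hsq]
        exact Finset.sum_congr rfl fun h hh => by rw [if_pos hh]
      by_cases hvw : v = w
      · subst hvw
        rw [← neg_eq_zero, ← Finset.sum_neg_distrib, ← hw, ← hsq]
        refine Finset.sum_congr rfl fun h hh => ?_
        rw [if_pos hh, (hjoin h hh).sign_eq_neg]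
        simp
      · rw [← hφ v]
        refine Finset.sum_congr rfl fun h hh => ?_
        rw [if_neg]
        exact fun hh' => ((hjoin h hh').mem_edgesAt_iff.1 hh).elim hvu hvw
    · dsimp only
      split_ifs with hh
      · exact hG.cast_sign_ne_zero hh
      · rw [Ne, h0]
        rintro rfl
        exact hh heu
  · obtain ⟨φ, hφ, h0⟩ := hG.exists_flow g
    have hw := hG.sign_mul_eq hφ (h3 w)
      (fun h hh h0' => hgw ((h0 h).1 h0' ▸ hh)) hew hfw
    have hsum := isFlow_iff_sum_edgesAt.1 hφ u
    rw [hu, Finset.sum_insert (by simp [hef, hge.symm]), Finset.sum_pair hgf.symm,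
      (h0 g).2 rfl] at hsum
    rw [he.sign_eq_neg, hf.sign_eq_neg] at hw
    push_cast at hw
    have hne : (G.sign u e : ZMod 3) * φ e ≠ 0 :=
      mul_ne_zero (hG.cast_sign_ne_zero heu) (mt (h0 e).1 hge.symm)
    have h2 : ∀ x y : ZMod 3, x + (y + 0) = 0 → x = y → x = 0 := by decide
    rw [mul_zero] at hsum
    exact hne (h2 _ _ hsum (by simpa using hw))

/-- The simple graph underlying a flow-critical graph. -/
def FlowCritical.toSimpleGraph (hG : G.FlowCritical (ZMod 3)) : SimpleGraph G.V where
  Adj := G.Adj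
  symm := ⟨fun _ _ ⟨e, he⟩ => ⟨e, he.symm⟩⟩
  loopless := ⟨fun _ ⟨_, he⟩ => hG.joins_ne he rfl⟩

theorem FlowCritical.not_colorable_two (hG : G.FlowCritical (ZMod 3))
    (h3 : ∀ v, (G.edgesAt v).card = 3) : ¬ hG.toSimpleGraph.Colorable 2 := by
  rintro ⟨c⟩
  refine hG.2.1 ⟨fun e => if c (G.tail e) = 0 then 1 else -1, isFlow_iff_sum_edgesAt.2 fun v => ?_,
    fun e => by dsimp only; split_ifs <;> decide⟩
  have hc : ∀ e, c (G.tail e) ≠ c (G.head e) := fun e => c.valid ⟨e, .inl ⟨rfl, rfl⟩⟩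
  rw [Finset.sum_congr rfl (g := fun _ => if c v = 0 then (-1 : ZMod 3) else 1), Finset.sum_const,
    h3]
  · split_ifs <;> decide
  · intro e he
    have hce := hc e
    have hne := hG.tail_ne_head e
    rcases mem_edgesAt.1 he with rfl | rfl
    · simp [sign, hne.symm]
    · simp [sign, hne]
      generalize c (G.tail e) = x at *
      generalize c (G.head e) = y at *
      revert x y
      decide

theorem FlowCritical.exists_coloring (hG : G.FlowCritical (ZMod 3))
    (h3 : ∀ v, (G.edgesAt v).card = 3) {u w : G.V} (huw : G.Adj u w) :
    ∃ c : G.V → Bool, ∀ a b, G.Adj a b → a ≠ u → a ≠ w → b ≠ u → b ≠ w → c a ≠ c b := by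
  obtain ⟨e, he⟩ := huw
  have he : G.Joins e u w := he
  obtain ⟨φ, hφ, h0⟩ := hG.exists_flow e
  refine ⟨fun v => decide (∃ f ∈ G.edgesAt v, (G.sign v f : ZMod 3) * φ f = 1), ?_⟩
  have hc : ∀ v, v ≠ u → v ≠ w → ∀ f ∈ G.edgesAt v,
      ((∃ f ∈ G.edgesAt v, (G.sign v f : ZMod 3) * φ f = 1) ↔ (G.sign v f : ZMod 3) * φ f = 1) := by
    intro v hu hw f hf
    refine ⟨?_, fun h => ⟨f, hf, h⟩⟩
    rintro ⟨g, hg, h⟩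
    rw [← h]
    refine hG.sign_mul_eq hφ (h3 v) (fun k hk hk0 => ?_) hf hg
    rw [h0] at hk0
    exact (he.mem_edgesAt_iff.1 (hk0 ▸ hk)).elim hu hw
  rintro a b ⟨f, hf⟩ hau haw hbu hbw
  have hf : G.Joins f a b := hf
  have hfa : f ∈ G.edgesAt a := hf.mem_edgesAt_iff.2 (.inl rfl)
  have hfb : f ∈ G.edgesAt b := hf.mem_edgesAt_iff.2 (.inr rfl)
  simp only [hc a hau haw f hfa, hc b hbu hbw f hfb, hf.sign_eq_neg, ne_eq, decide_eq_decide]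
  have hne : (G.sign a f : ZMod 3) * φ f ≠ 0 := by
    refine mul_ne_zero (hG.cast_sign_ne_zero hfa) fun h => ?_
    rw [h0] at h
    exact (he.mem_edgesAt_iff.1 (h ▸ hfa)).elim hau haw
  push_cast
  rw [neg_mul]
  generalize (G.sign a f : ZMod 3) * φ f = x at *
  revert x
  decide

theorem FlowCritical.isRegularOfDegree (hG : G.FlowCritical (ZMod 3))
    (h3 : ∀ v, (G.edgesAt v).card = 3) [DecidableRel hG.toSimpleGraph.Adj] :
    hG.toSimpleGraph.IsRegularOfDegree 3 := by
  intro v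
  let other : G.E → G.V := fun e => if G.tail e = v then G.head e else G.tail e
  have hother : ∀ e ∈ G.edgesAt v, G.Joins e v (other e) := by
    intro e he
    have := mem_edgesAt.1 he
    simp only [Joins, other]
    grind
  rw [← SimpleGraph.card_neighborFinset_eq_degree, ← h3 v]
  refine (Finset.card_bij (fun e _ => other e) (fun e he => ?_) (fun e he f hf h => ?_)
    fun w hw => ?_).symm
  · rw [SimpleGraph.mem_neighborFinset]
    exact ⟨e, hother e he⟩
  · exact hG.eq_of_joins h3 (hother e he) (h ▸ hother f hf)
  · rw [SimpleGraph.mem_neighborFinset] at hw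
    obtain ⟨e, he⟩ := hw
    have he : G.Joins e v w := he
    refine ⟨e, he.mem_edgesAt_iff.2 (.inl rfl), ?_⟩
    have := hG.joins_ne he
    simp only [Joins] at he
    simp only [other]
    grind

/-- A simple complete graph on four vertices is isomorphic to `K₄`. -/
theorem iso_K4_of_forall_adj (hV : Fintype.card G.V = 4) (hadj : ∀ a b : G.V, a ≠ b ↔ G.Adj a b)
    (huniq : ∀ (e f : G.E) (a b : G.V), G.Joins e a b → G.Joins f a b → e = f) : Iso G K4 := by
  obtain ⟨F⟩ : Nonempty (K4.V ≃ G.V) :=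
    Fintype.card_eq.1 (by rw [hV]; rfl)
  have hne : ∀ k : K4.E, K4.tail k ≠ K4.head k := by decide
  have hex : ∀ i j : K4.V, i ≠ j → ∃ k : K4.E, K4.Joins k i j := by
    unfold Joins
    decide
  have hinj : ∀ k l : K4.E, K4.Joins k (K4.tail l) (K4.head l) → k = l := by
    unfold Joins
    decide
  choose g hg using fun k => (hadj (F (K4.tail k)) (F (K4.head k))).1 (F.injective.ne (hne k))
  have hg : ∀ k, G.Joins (g k) (F (K4.tail k)) (F (K4.head k)) := hg
  refine iso_of_bijective F.bijective ⟨fun k l hkl => hinj k l ?_, fun e => ?_⟩ hg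
  · have hk := hg k
    have hl := hg l
    rw [hkl] at hk
    have : ∀ a b, F a = F b → a = b := fun a b h => F.injective h
    simp only [Joins] at *
    grind
  · have hne' := (hadj (G.tail e) (G.head e)).2 ⟨e, .inl ⟨rfl, rfl⟩⟩
    obtain ⟨k, hk⟩ := hex _ _ (F.symm.injective.ne hne')
    refine ⟨k, huniq _ _ (G.tail e) (G.head e) ?_ (.inl ⟨rfl, rfl⟩)⟩
    have := hg k
    rcases hk with ⟨h₁, h₂⟩ | ⟨h₁, h₂⟩ <;> rw [h₁, h₂] at this <;>
      simpa [Joins, or_comm] using this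

end MultiGraph

/-- A connected cubic graph which is not bipartite, but becomes bipartite after the deletion of
the ends of any edge, has four vertices. -/
theorem card_eq_four_of_cubic {V : Type*} [Fintype V] [DecidableEq V] (S : SimpleGraph V)
    [DecidableRel S.Adj] (hcon : S.Preconnected) (hreg : S.IsRegularOfDegree 3)
    (hodd : ∃ (v : V) (w : S.Walk v v), Odd w.length)
    (hcol : ∀ u w, S.Adj u w → ∃ c : V → Bool, ∀ a b, S.Adj a b →
      a ≠ u → a ≠ w → b ≠ u → b ≠ w → c a ≠ c b) :
    Fintype.card V = 4 := by
  classical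
  have hex : ∃ n, Odd n ∧ ∃ (v : V) (w : S.Walk v v), w.length = n := by
    obtain ⟨v, w, hw⟩ := hodd
    exact ⟨_, hw, v, w, rfl⟩
  obtain ⟨hn, v₀, C, hC⟩ := Nat.find_spec hex
  have hmin : ∀ (v : V) (w : S.Walk v v), Odd w.length → Nat.find hex ≤ w.length :=
    fun v w h => Nat.find_min' hex ⟨h, v, w, rfl⟩
  set n := Nat.find hex
  let W (a b : V) (k : ℕ) : Prop := ∃ w : S.Walk a b, w.length = k
  have hp0 : C.getVert 0 = C.getVert n := by simp [← hC]
  set p : ℕ → V := C.getVert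
  have hadj : ∀ i < n, S.Adj (p i) (p (i + 1)) := fun i hi => C.adj_getVert_succ (hC ▸ hi)
  have hmin' : ∀ {a k}, W a a k → Odd k → n ≤ k := by
    rintro a k ⟨w, rfl⟩ hk
    exact hmin a w hk
  have htrans : ∀ {a b c k l}, W a b k → W b c l → W a c (k + l) := by
    rintro a b c k l ⟨w, rfl⟩ ⟨w', rfl⟩
    exact ⟨w.append w', w.length_append w'⟩
  have hsymm : ∀ {a b k}, W a b k → W b a k := by
    rintro a b k ⟨w, rfl⟩
    exact ⟨w.reverse, w.length_reverse⟩
  have hone : ∀ {a b}, S.Adj a b → W a b 1 := fun h => ⟨h.toWalk, rfl⟩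
  have harc : ∀ i d, i + d ≤ n → W (p i) (p (i + d)) d := by
    intro i d
    induction d with
    | zero => exact fun _ => ⟨.nil, rfl⟩
    | succ d ih => exact fun h => htrans (ih (by omega)) (hone (hadj (i + d) (by omega)))
  have harc₁ : ∀ i j, i ≤ j → j ≤ n → W (p i) (p j) (j - i) := by
    intro i j hij hj
    have := harc i (j - i) (by omega)
    rwa [Nat.add_sub_of_le hij] at this
  have harc₂ : ∀ i j, i ≤ j → j ≤ n → W (p i) (p j) (i + (n - j)) := by
    intro i j hij hj
    have h := harc₁ 0 i (by omega) (by omega)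
    rw [hp0] at h
    exact htrans (hsymm h) (hsymm (harc₁ j n hj le_rfl))
  have hmeet : ∀ u w, S.Adj u w → (∃ i < n, p i = u) ∨ ∃ i < n, p i = w := by
    intro u w huw
    by_contra! hne
    obtain ⟨hu, hw⟩ := hne
    obtain ⟨c, hc⟩ := hcol u w huw
    have hpos := hn.pos
    have hu' : ∀ i ≤ n, p i ≠ u := by
      intro i hi
      rcases hi.lt_or_eq with h | rfl
      · exact hu i h
      · exact hp0 ▸ hu 0 hpos
    have hw' : ∀ i ≤ n, p i ≠ w := by
      intro i hi
      rcases hi.lt_or_eq with h | rfl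
      · exact hw i h
      · exact hp0 ▸ hw 0 hpos
    have halt : ∀ i ≤ n, (c (p i) = c (p 0) ↔ Even i) := by
      intro i
      induction i with
      | zero => simp
      | succ i ih =>
        intro hi
        have h1 := ih (by omega)
        have h2 := hc _ _ (hadj i (by omega)) (hu' i (by omega)) (hw' i (by omega)) (hu' _ hi)
          (hw' _ hi)
        rw [Nat.even_add_one, ← h1]
        revert h2
        cases c (p i) <;> cases c (p (i + 1)) <;> cases c (p 0) <;> simp
    exact Nat.not_even_iff_odd.2 hn ((halt n le_rfl).1 (by rw [hp0]))
  have hchord : ∀ j < n, S.Adj (p 0) (p j) → j = 1 ∨ j = n - 1 := by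
    intro j hj h
    have h₁ := hmin' (htrans (harc₁ 0 j (by omega) hj.le) (hone h.symm))
    have h₂ := hmin' (htrans (harc₂ 0 j (by omega) hj.le) (hone h.symm))
    have hj0 : j ≠ 0 := by
      rintro rfl
      exact h.ne rfl
    rw [Nat.odd_iff] at h₁ h₂ hn
    omega
  have h3 : ∀ v, Finset.card (S.neighborFinset v) = 3 := fun v => hreg v
  obtain ⟨y, hy, hyC⟩ : ∃ y, S.Adj (p 0) y ∧ ∀ i < n, p i ≠ y := by
    obtain ⟨y, hy, hy'⟩ : ∃ y ∈ S.neighborFinset (p 0), y ∉ ({p 1, p (n - 1)} : Finset V) := by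
      refine Finset.exists_mem_notMem_of_card_lt_card ?_
      rw [h3]
      exact card_le_two.trans_lt (by norm_num)
    rw [SimpleGraph.mem_neighborFinset] at hy
    refine ⟨y, hy, ?_⟩
    rintro j hj rfl
    rcases hchord j hj hy with rfl | rfl <;> simp at hy'
  have hyN : ∀ v, S.Adj y v → ∃ i < n, p i = v := by
    intro v hv
    rcases hmeet y v hv with ⟨i, hi, h⟩ | h
    · exact absurd h (hyC i hi)
    · exact h
  obtain ⟨v₁, v₂, v₃, h₁₂, h₁₃, h₂₃, hyv⟩ := Finset.card_eq_three.1 (h3 y)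
  have hyv' : ∀ v, S.Adj y v ↔ v = v₁ ∨ v = v₂ ∨ v = v₃ := by
    intro v
    rw [← SimpleGraph.mem_neighborFinset, hyv]
    simp
  obtain ⟨i₁, hi₁, rfl⟩ := hyN v₁ ((hyv' _).2 (by simp))
  obtain ⟨i₂, hi₂, rfl⟩ := hyN v₂ ((hyv' _).2 (by simp))
  obtain ⟨i₃, hi₃, rfl⟩ := hyN v₃ ((hyv' _).2 (by simp))
  have e₁ : S.Adj y (p i₁) := (hyv' _).2 (by simp)
  have e₂ : S.Adj y (p i₂) := (hyv' _).2 (by simp)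
  have e₃ : S.Adj y (p i₃) := (hyv' _).2 (by simp)
  have n₁₂ : i₁ ≠ i₂ := fun h => h₁₂ (h ▸ rfl)
  have n₁₃ : i₁ ≠ i₃ := fun h => h₁₃ (h ▸ rfl)
  have n₂₃ : i₂ ≠ i₃ := fun h => h₂₃ (h ▸ rfl)
  have hpair : ∀ i j, i < j → j < n → S.Adj y (p i) → S.Adj y (p j) →
      (Odd (j - i) → n ≤ j - i + 2) ∧ (Odd (i + (n - j)) → n ≤ i + (n - j) + 2) := by
    intro i j hij hj hi' hj'
    have hji := htrans (hone hj'.symm) (hone hi')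
    exact ⟨fun h => hmin' (htrans (harc₁ i j hij.le hj.le) hji) (h.add_even even_two),
      fun h => hmin' (htrans (harc₂ i j hij.le hj.le) hji) (h.add_even even_two)⟩
  have hn3 : n = 3 := by
    have key : ∀ i j k, i < j → j < k → k < n → S.Adj y (p i) → S.Adj y (p j) → S.Adj y (p k) →
        n = 3 := by
      intro i j k hij hjk hk hi hj hk'
      have h₁ := hpair i j hij (hjk.trans hk) hi hj
      have h₂ := hpair j k hjk hk hj hk'
      have h₃ := hpair i k (hij.trans hjk) hk hi hk'
      simp only [Nat.odd_iff] at h₁ h₂ h₃ hn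
      omega
    grind
  have hyp : ∀ i < n, S.Adj y (p i) := by
    intro i hi
    have : i = i₁ ∨ i = i₂ ∨ i = i₃ := by omega
    rcases this with rfl | rfl | rfl <;> assumption
  have a01 : S.Adj (p 0) (p 1) := hadj 0 (by omega)
  have a12 : S.Adj (p 1) (p 2) := hadj 1 (by omega)
  have a20 : S.Adj (p 2) (p 0) := by
    rw [hp0, hn3]
    exact hadj 2 (by omega)
  have y0 := hyp 0 (by omega)
  have y1 := hyp 1 (by omega)
  have y2 := hyp 2 (by omega)
  have hfull : ∀ a b c d, S.Adj a b → S.Adj a c → S.Adj a d → b ≠ c → b ≠ d → c ≠ d →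
      ∀ v, S.Adj a v → v = b ∨ v = c ∨ v = d := by
    intro a b c d hb hc hd hbc hbd hcd v hv
    have hsub : {b, c, d} ⊆ S.neighborFinset a := by
      intro x
      simp only [mem_insert, mem_singleton, SimpleGraph.mem_neighborFinset]
      rintro (rfl | rfl | rfl) <;> assumption
    have := Finset.eq_of_subset_of_card_le hsub
      (by rw [h3, Finset.card_eq_three.2 ⟨b, c, d, hbc, hbd, hcd, rfl⟩])
    rw [← SimpleGraph.mem_neighborFinset, ← this] at hv
    simpa using hv
  have hclosed : ∀ v, v ∈ ({y, p 0, p 1, p 2} : Finset V) := by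
    intro v
    obtain ⟨w⟩ := hcon y v
    suffices ∀ a b (w : S.Walk a b), a ∈ ({y, p 0, p 1, p 2} : Finset V) →
      b ∈ ({y, p 0, p 1, p 2} : Finset V) from this y v w (by simp)
    intro a b w
    induction w with
    | nil => exact id
    | cons h _ ih =>
      refine fun ha => ih ?_
      simp only [mem_insert, mem_singleton] at ha ⊢
      rcases ha with rfl | rfl | rfl | rfl
      · have := hfull _ _ _ _ y0 y1 y2 a01.ne a20.ne' a12.ne _ h
        tauto
      · have := hfull _ _ _ _ y0.symm a01 a20.symm y1.ne y2.ne a12.ne _ h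
        tauto
      · have := hfull _ _ _ _ y1.symm a01.symm a12 y0.ne y2.ne a20.ne' _ h
        tauto
      · have := hfull _ _ _ _ y2.symm a20 a12.symm y0.ne y1.ne a01.ne _ h
        tauto
  rw [← Finset.card_univ, ← Finset.eq_univ_of_forall hclosed]
  rw [Finset.card_insert_of_notMem, Finset.card_eq_three.2 ⟨_, _, _, a01.ne, a20.ne', a12.ne, rfl⟩]
  simp [y0.ne, y1.ne, y2.ne]
open MultiGraph in
/-- If `G ≠ K₂` is a `ℤ/3`-flow-critical graph of maximum degree three, then
`G = K₄`. -/
theorem eq_K4_of_maxDegree_three (G : MultiGraph)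
    (hG : G.FlowCritical (ZMod 3)) (hK2 : ¬ Iso G K2)
    (hdeg : ∀ v : G.V, G.degree v ≤ 3) :
    Iso G K4 := by
  classical
  have h3 := hG.card_edgesAt_eq_three hK2 hdeg
  have hreg := hG.isRegularOfDegree h3
  have hodd := hG.not_colorable_two h3
  rw [SimpleGraph.two_colorable_iff_forall_loop_even] at hodd
  push Not at hodd
  have hcon : hG.toSimpleGraph.Preconnected := fun a b => by
    rw [SimpleGraph.reachable_iff_reflTransGen]
    exact hG.1.2 a b
  have hV := card_eq_four_of_cubic hG.toSimpleGraph hcon hreg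
    (by simpa only [Nat.not_even_iff_odd] using hodd) fun u w h => hG.exists_coloring h3 h
  refine iso_K4_of_forall_adj hV (fun a b => ⟨fun hab => ?_, fun ⟨e, he⟩ => hG.joins_ne he⟩)
    fun e f a b => hG.eq_of_joins h3
  have hN : hG.toSimpleGraph.neighborFinset a = univ.erase a := by
    refine Finset.eq_of_subset_of_card_le (fun x hx => ?_) ?_
    · rw [SimpleGraph.mem_neighborFinset] at hx
      simp [hx.ne']
    · rw [Finset.card_erase_of_mem (mem_univ a), Finset.card_univ, hV]
      exact (hreg a).ge
  have hb : b ∈ hG.toSimpleGraph.neighborFinset a := by simp [hN, hab.symm]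
  rwa [SimpleGraph.mem_neighborFinset] at hb
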